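/- Let A and B be groups such that A is nontrivial, B is nontrivial, and it is not the case that A and B both have order two. Then the free product A ∗ B contains a free subgroup of rank two; that is, there exists an injective group homomorphism from the free group on two generators into A ∗ B. -/

import Mathlib

universe u v

namespace Monoid.CoprodI

open scoped Pointwise commutatorElement
open Word

variable {ι : Type*} {G : ι → Type*} [∀ i, Group (G i)]
  [DecidableEq ι] [∀ i, DecidableEq (G i)]

theorem Word.equivPair_head_of_smul {i : ι} (m : G i) (w : Word G) :
    (equivPair i ((of m : CoprodI G) • w)).head = m * (equivPair i w).head := by
  rw [equivPair_smul_same]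

theorem Word.equivPair_head_eq_one_of_ne {i j : ι} (hij : i ≠ j) {w : Word G}
    (h : (equivPair i w).head ≠ 1) : (equivPair j w).head = 1 := by
  have hi : w.fstIdx = some i := by
    by_contra hne
    exact h (by rw [equivPair_eq_of_fstIdx_ne hne])
  rw [equivPair_eq_of_fstIdx_ne (by rw [hi]; simpa using hij)]

/-- The reduced words whose first two letters are `a : G i` and `b : G j`
(when `i ≠ j` and `a`, `b` are nontrivial). -/
def Word.startsWith {i j : ι} (a : G i) (b : G j) : Set (Word G) :=
  {w | (equivPair i w).head = a ∧ (equivPair j ((of a : CoprodI G)⁻¹ • w)).head = b}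

theorem Word.commutator_smul_mem_startsWith {i j : ι} (hij : i ≠ j) {a : G i} {b : G j}
    (ha : a ≠ 1) (hb : b ≠ 1) {w : Word G} (hw : w ∉ startsWith b a) :
    ⁅(of a : CoprodI G), of b⁆ • w ∈ startsWith a b := by
  set u := (of b : CoprodI G)⁻¹ • w with hu
  have hua : (equivPair i u).head ≠ a := by
    intro h
    refine hw ⟨?_, h⟩
    have h1 := equivPair_head_eq_one_of_ne hij (h.trans_ne ha)
    rwa [hu, ← map_inv, equivPair_head_of_smul, inv_mul_eq_one, eq_comm] at h1
  have h1 : (equivPair j ((of a : CoprodI G)⁻¹ • u)).head = 1 := by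
    apply equivPair_head_eq_one_of_ne hij
    rw [← map_inv, equivPair_head_of_smul]
    rwa [ne_eq, inv_mul_eq_one, eq_comm]
  have h2 : (equivPair j ((of b : CoprodI G) • (of a : CoprodI G)⁻¹ • u)).head = b := by
    rw [equivPair_head_of_smul, h1, mul_one]
  have h3 : ⁅(of a : CoprodI G), of b⁆ • w =
      (of a : CoprodI G) • (of b : CoprodI G) • (of a : CoprodI G)⁻¹ • u := by
    simp only [hu, commutatorElement_def, mul_smul]
  rw [h3]
  refine ⟨?_, by rwa [inv_smul_smul]⟩
  rw [equivPair_head_of_smul, equivPair_head_eq_one_of_ne hij.symm (h2.trans_ne hb), mul_one]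

theorem Word.disjoint_startsWith_swap {i j : ι} (hij : i ≠ j) {a a' : G i} {b b' : G j}
    (ha : a ≠ 1) (hb : b ≠ 1) : Disjoint (startsWith a b') (startsWith b a') :=
  Set.disjoint_left.2 fun _ hw hw' =>
    hb (hw'.1.symm.trans (equivPair_head_eq_one_of_ne hij (hw.1.trans_ne ha)))

/-- In a free product, the commutators of distinct nontrivial elements of one factor with a fixed
nontrivial element of another factor freely generate a free group. -/
theorem injective_freeGroup_lift_commutator {ι : Type u} {G : ι → Type v} [∀ i, Group (G i)]
    {κ : Type (max u v)} [Nontrivial κ] {i j : ι} (hij : i ≠ j) {a : κ → G i}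
    (ha : Function.Injective a) (ha1 : ∀ k, a k ≠ 1) {b : G j} (hb : b ≠ 1) :
    Function.Injective (FreeGroup.lift fun k => ⁅(of (a k) : CoprodI G), of b⁆) := by
  classical
  refine FreeGroup.injective_lift_of_ping_pong _
    (α := Word G) (fun k => startsWith (a k) b) (fun k => startsWith b (a k)) ?_ ?_ ?_ ?_ ?_ ?_
  · intro k
    refine ⟨_, commutator_smul_mem_startsWith hij (ha1 k) hb (w := Word.empty) fun h => hb ?_⟩
    rw [← h.1, equivPair_eq_of_fstIdx_ne (by simp [fstIdx, Word.empty])]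
  · exact fun k l hkl => Set.disjoint_left.2 fun w hw hw' => hkl (ha (hw.1.symm.trans hw'.1))
  · exact fun k l hkl => Set.disjoint_left.2 fun w hw hw' => hkl (ha (hw.2.symm.trans hw'.2))
  · exact fun k l => disjoint_startsWith_swap hij (ha1 k) hb
  · rintro k _ ⟨w, hw, rfl⟩
    exact commutator_smul_mem_startsWith hij (ha1 k) hb hw
  · rintro k _ ⟨w, hw, rfl⟩
    simpa only [Pi.inv_apply, commutatorElement_inv] using
      commutator_smul_mem_startsWith hij.symm hb (ha1 k) hw

end Monoid.CoprodI

namespace Monoid.Coprod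

open scoped commutatorElement

/-- The commutators `⁅a 0, b⁆` and `⁅a 1, b⁆`, where `a 0 ≠ a 1` and `b` are nontrivial, freely
generate a free subgroup of `A ∗ B`. -/
theorem injective_freeGroup_lift_commutator {A : Type u} {B : Type v} [Group A] [Group B]
    {a : Fin 2 → A} (ha : Function.Injective a) (ha1 : ∀ k, a k ≠ 1) {b : B} (hb : b ≠ 1) :
    Function.Injective
      (FreeGroup.lift fun k => ⁅(inl (a k) : Coprod A B), (inr b : Coprod A B)⁆) := by
  let G : Bool → Type (max u v) := fun c => cond c (ULift.{v} A) (ULift.{u} B)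
  let _ : ∀ c, Group (G c) := fun c => match c with
    | true => (ULift.group : Group (ULift.{v} A))
    | false => (ULift.group : Group (ULift.{u} B))
  let φ : A →* G true := (MulEquiv.ulift.symm : A ≃* ULift.{v} A).toMonoidHom
  let ψ : B →* G false := (MulEquiv.ulift.symm : B ≃* ULift.{u} B).toMonoidHom
  have hφ : Function.Injective φ := (MulEquiv.ulift.symm : A ≃* ULift.{v} A).injective
  have hψ : Function.Injective ψ := (MulEquiv.ulift.symm : B ≃* ULift.{u} B).injective
  let F : Coprod A B →* CoprodI G := lift (CoprodI.of.comp φ) (CoprodI.of.comp ψ)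
  let e : FreeGroup (Fin 2) ≃* FreeGroup (ULift.{max u v} (Fin 2)) :=
    FreeGroup.freeGroupCongr Equiv.ulift.symm
  have key := CoprodI.injective_freeGroup_lift_commutator (G := G) (κ := ULift.{max u v} (Fin 2))
    (i := true) (j := false) (by decide) (a := fun k => φ (a k.down))
    (hφ.comp (ha.comp ULift.down_injective))
    (fun k => (map_ne_one_iff φ hφ).2 (ha1 _)) ((map_ne_one_iff ψ hψ).2 hb)
  have hcomp : F.comp (FreeGroup.lift fun k => ⁅(inl (a k) : Coprod A B), (inr b : Coprod A B)⁆) =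
      (FreeGroup.lift fun k : ULift.{max u v} (Fin 2) =>
        ⁅(CoprodI.of (φ (a k.down)) : CoprodI G), CoprodI.of (ψ b)⁆).comp e.toMonoidHom := by
    ext k
    simp [F, e, map_commutatorElement]
  have hinj := key.comp e.injective
  refine Function.Injective.of_comp (f := F) ?_
  rw [← MonoidHom.coe_comp, hcomp]
  exact hinj

theorem exists_injective_freeGroup_of_card_ne_two {A : Type u} {B : Type v} [Group A] [Group B]
    [Nontrivial A] [Nontrivial B] (h : Nat.card A ≠ 2) :
    ∃ f : FreeGroup (Fin 2) →* Coprod A B, Function.Injective f := by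
  obtain ⟨x, hx⟩ := exists_ne (1 : A)
  obtain ⟨b, hb⟩ := exists_ne (1 : B)
  obtain ⟨y, hy, hyx⟩ : ∃ y : A, y ≠ 1 ∧ y ≠ x := by
    by_contra! hall
    refine h (Nat.card_eq_two_iff.2 ⟨1, x, hx.symm, Set.eq_univ_of_forall fun y => ?_⟩)
    by_cases hy : y = 1
    · exact Or.inl hy
    · exact Or.inr (hall y hy)
  refine ⟨_, injective_freeGroup_lift_commutator (a := ![x, y]) ?_ ?_ hb⟩
  · intro k l
    fin_cases k <;> fin_cases l <;> simp [hyx, hyx.symm]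
  · intro k
    fin_cases k <;> simp [hx, hy]

end Monoid.Coprod

theorem free_product_contains_free_subgroup_of_rank_two
    (A B : Type*) [Group A] [Group B]
    (hA : Nontrivial A) (hB : Nontrivial B)
    (h : ¬(Nat.card A = 2 ∧ Nat.card B = 2)) :
    ∃ f : FreeGroup (Fin 2) →* Monoid.Coprod A B, Function.Injective f := by
  by_cases hcA : Nat.card A = 2
  · obtain ⟨f, hf⟩ := Monoid.Coprod.exists_injective_freeGroup_of_card_ne_two (A := B) (B := A)
      fun hcB => h ⟨hcA, hcB⟩
    exact ⟨(Monoid.Coprod.swap B A).comp f, Monoid.Coprod.swap_injective.comp hf⟩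
  · exact Monoid.Coprod.exists_injective_freeGroup_of_card_ne_two hcA
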